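/- (Discrete forced-pair theorem) Let a, b, c, d be integers with a·b·c·d < 0, let u, v be non-parallel integer vectors, and let G be a finite connected subgraph of the infinite grid graph on ℤ². If G realises both a·u + b·v and c·u + d·v, then G realises u or G realises v. -/

import Mathlib

def gridAdj (a b : ℤ × ℤ) : Prop := |a.1 - b.1| + |a.2 - b.2| = 1

def realises (S : Finset (ℤ × ℤ)) (v : ℤ × ℤ) : Prop := ∃ a ∈ S, ∃ b ∈ S, a - b = v

def connectedIn (S : Finset (ℤ × ℤ)) : Prop :=
  ∀ a ∈ S, ∀ b ∈ S, Relation.ReflTransGen (fun x y => x ∈ S ∧ y ∈ S ∧ gridAdj x y) a b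

def nonParallel (u v : ℤ × ℤ) : Prop := u.1 * v.2 - u.2 * v.1 ≠ 0

/-! ### Discrete angles -/

noncomputable def cz (z : ℤ × ℤ) : ℂ := ⟨(z.1 : ℝ), (z.2 : ℝ)⟩

lemma cz_add (x y : ℤ × ℤ) : cz (x + y) = cz x + cz y := by
  apply Complex.ext <;> simp [cz]

lemma cz_sub (x y : ℤ × ℤ) : cz (x - y) = cz x - cz y := by
  apply Complex.ext <;> simp [cz]

lemma cz_neg (x : ℤ × ℤ) : cz (-x) = -cz x := by
  apply Complex.ext <;> simp [cz]

lemma cz_smul (k : ℤ) (x : ℤ × ℤ) : cz (k • x) = ((k : ℝ) : ℂ) * cz x := by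
  apply Complex.ext <;> simp [cz]

lemma cz_ne {x : ℤ × ℤ} (h : x ≠ 0) : cz x ≠ 0 := by
  intro hc
  apply h
  have h1 := congrArg Complex.re hc
  have h2 := congrArg Complex.im hc
  simp [cz] at h1 h2
  exact Prod.ext h1 h2

noncomputable def ang (z w : ℤ × ℤ) : ℝ := Complex.arg (cz w / cz z)

lemma ang_coe {z w : ℤ × ℤ} (hz : z ≠ 0) (hw : w ≠ 0) :
    (ang z w : Real.Angle) = (Complex.arg (cz w) : Real.Angle) - (Complex.arg (cz z) : Real.Angle) :=
  Complex.arg_div_coe_angle (cz_ne hw) (cz_ne hz)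

lemma gridAdj_cases {z w : ℤ × ℤ} (h : gridAdj z w) :
    (w.1 = z.1 + 1 ∧ w.2 = z.2) ∨ (w.1 = z.1 - 1 ∧ w.2 = z.2) ∨
    (w.1 = z.1 ∧ w.2 = z.2 + 1) ∨ (w.1 = z.1 ∧ w.2 = z.2 - 1) := by
  unfold gridAdj at h
  rcases abs_cases (z.1 - w.1) with h1 | h1 <;> rcases abs_cases (z.2 - w.2) with h2 | h2 <;> omega

lemma sq_aux (a b : ℤ) (h0 : ¬ (a = 0 ∧ b = 0)) (h1 : ¬ (a = -1 ∧ b = 0)) :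
    0 < a * (a + 1) + b * b := by
  have hb : 0 ≤ b * b := mul_self_nonneg b
  have ha : 0 ≤ a * (a + 1) := by
    rcases le_or_gt 0 a with h | h
    · positivity
    · nlinarith
  by_contra hc
  have hb0 : b * b = 0 := by omega
  have ha0 : a * (a + 1) = 0 := by omega
  have : b = 0 := by simpa using hb0
  rcases mul_eq_zero.1 ha0 with h | h
  · exact h0 ⟨h, this⟩
  · exact h1 ⟨by omega, this⟩

lemma ang_lt {z w : ℤ × ℤ} (hz : z ≠ 0) (hw : w ≠ 0) (h : gridAdj z w) :
    |ang z w| < Real.pi / 2 := by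
  unfold ang
  rw [Complex.abs_arg_lt_pi_div_two_iff]
  left
  have hz' : ¬ (z.1 = 0 ∧ z.2 = 0) := fun h => hz (Prod.ext h.1 h.2)
  have hw' : ¬ (w.1 = 0 ∧ w.2 = 0) := fun h => hw (Prod.ext h.1 h.2)
  have key : 0 < w.1 * z.1 + w.2 * z.2 := by
    rcases gridAdj_cases h with ⟨h1, h2⟩ | ⟨h1, h2⟩ | ⟨h1, h2⟩ | ⟨h1, h2⟩ <;> rw [h1, h2] at hw' ⊢
    · have := sq_aux z.1 z.2 hz' (by omega); nlinarith
    · have := sq_aux (-z.1) z.2 (by omega) (by omega); nlinarith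
    · have := sq_aux z.2 z.1 (by omega) (by omega); nlinarith
    · have := sq_aux (-z.2) z.1 (by omega) (by omega); nlinarith
  have keyR : (0 : ℝ) < w.1 * z.1 + w.2 * z.2 := by exact_mod_cast key
  have hn : 0 < Complex.normSq (cz z) := Complex.normSq_pos.2 (cz_ne hz)
  rw [Complex.div_re, ← add_div]
  apply div_pos _ hn
  simpa [cz] using keyR

lemma eq_of_angle {x y : ℝ} (h : (x : Real.Angle) = (y : Real.Angle))
    (hlt : |x - y| < 2 * Real.pi) : x = y := by
  obtain ⟨k, hk⟩ := Real.Angle.angle_eq_iff_two_pi_dvd_sub.1 h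
  rw [hk, abs_mul, abs_of_pos Real.two_pi_pos] at hlt
  have h1 : |(k : ℝ)| < 1 := by
    have := Real.two_pi_pos
    by_contra hc
    push Not at hc
    nlinarith
  have h2 : |k| < 1 := by exact_mod_cast h1
  have h3 : k = 0 := Int.abs_lt_one_iff.1 h2
  rw [h3] at hk
  simp at hk
  linarith

lemma ang_square {p q r s : ℤ × ℤ} (hp : p ≠ 0) (hq : q ≠ 0) (hr : r ≠ 0) (hs : s ≠ 0)
    (h1 : gridAdj p q) (h2 : gridAdj q s) (h3 : gridAdj p r) (h4 : gridAdj r s) :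
    ang p q + ang q s = ang p r + ang r s := by
  apply eq_of_angle
  · rw [Real.Angle.coe_add, Real.Angle.coe_add]
    rw [ang_coe hp hq, ang_coe hq hs, ang_coe hp hr, ang_coe hr hs]
    abel
  · have a1 := abs_lt.1 (ang_lt hp hq h1)
    have a2 := abs_lt.1 (ang_lt hq hs h2)
    have a3 := abs_lt.1 (ang_lt hp hr h3)
    have a4 := abs_lt.1 (ang_lt hr hs h4)
    rw [abs_lt]
    constructor <;> linarith [a1.1, a1.2, a2.1, a2.2, a3.1, a3.2, a4.1, a4.2]

noncomputable def bet (u z : ℤ × ℤ) : ℝ := Complex.arg (cz z / cz u)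
noncomputable def hgt (u z : ℤ × ℤ) : ℝ := (cz z / cz u).im

lemma hgt_sub (u x y : ℤ × ℤ) : hgt u (x - y) = hgt u x - hgt u y := by
  simp only [hgt, cz_sub, sub_div, Complex.sub_im]

lemma hgt_add (u x y : ℤ × ℤ) : hgt u (x + y) = hgt u x + hgt u y := by
  simp only [hgt, cz_add, add_div, Complex.add_im]

lemma hgt_neg (u x : ℤ × ℤ) : hgt u (-x) = - hgt u x := by
  simp only [hgt, cz_neg, neg_div, Complex.neg_im]

lemma hgt_smul {u : ℤ × ℤ} (hu : u ≠ 0) (k : ℤ) : hgt u (k • u) = 0 := by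
  simp only [hgt, cz_smul]
  rw [mul_div_assoc, div_self (cz_ne hu), mul_one, Complex.ofReal_im]

lemma bet_pos {u : ℤ × ℤ} (hu : u ≠ 0) (k : ℤ) (hk : 0 < k) : bet u (k • u) = 0 := by
  simp only [bet, cz_smul]
  rw [mul_div_assoc, div_self (cz_ne hu), mul_one]
  exact Complex.arg_ofReal_of_nonneg (by exact_mod_cast hk.le)

lemma bet_neg {u : ℤ × ℤ} (hu : u ≠ 0) (k : ℤ) (hk : k < 0) : bet u (k • u) = Real.pi := by
  simp only [bet, cz_smul]
  rw [mul_div_assoc, div_self (cz_ne hu), mul_one]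
  exact Complex.arg_ofReal_of_neg (by exact_mod_cast hk)

lemma ang_upper {u z w : ℤ × ℤ} (hu : u ≠ 0) (hz : z ≠ 0) (hw : w ≠ 0) (h : gridAdj z w)
    (h1 : 0 ≤ hgt u z) (h2 : 0 ≤ hgt u w) : ang z w = bet u w - bet u z := by
  apply eq_of_angle
  · rw [Real.Angle.coe_sub]
    rw [ang_coe hz hw, bet, bet, Complex.arg_div_coe_angle (cz_ne hw) (cz_ne hu),
      Complex.arg_div_coe_angle (cz_ne hz) (cz_ne hu)]
    abel
  · have a1 := abs_lt.1 (ang_lt hz hw h)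
    have b1 : 0 ≤ bet u z := Complex.arg_nonneg_iff.2 h1
    have b2 : 0 ≤ bet u w := Complex.arg_nonneg_iff.2 h2
    have c1 : bet u z ≤ Real.pi := Complex.arg_le_pi _
    have c2 : bet u w ≤ Real.pi := Complex.arg_le_pi _
    have := Real.pi_pos
    rw [abs_lt]
    constructor <;> linarith [a1.1, a1.2]

lemma gridAdj_neg {z w : ℤ × ℤ} (h : gridAdj z w) : gridAdj (-z) (-w) := by
  unfold gridAdj at *
  rw [← h, abs_sub_comm z.1, abs_sub_comm z.2]
  simp only [Prod.fst_neg, Prod.snd_neg]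
  congr 2 <;> ring

lemma gridAdj_symm {z w : ℤ × ℤ} (h : gridAdj z w) : gridAdj w z := by
  unfold gridAdj at *
  rw [← h, abs_sub_comm z.1, abs_sub_comm z.2]

lemma gridAdj_add {z w : ℤ × ℤ} (h : gridAdj z w) (t : ℤ × ℤ) : gridAdj (z + t) (w + t) := by
  unfold gridAdj at *
  rw [← h]
  simp

lemma ang_neg (z w : ℤ × ℤ) : ang (-z) (-w) = ang z w := by
  unfold ang
  rw [cz_neg, cz_neg, neg_div_neg_eq]

lemma ang_lower {u z w : ℤ × ℤ} (hu : u ≠ 0) (hz : z ≠ 0) (hw : w ≠ 0) (h : gridAdj z w)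
    (h1 : hgt u z ≤ 0) (h2 : hgt u w ≤ 0) : ang z w = bet u (-w) - bet u (-z) := by
  rw [← ang_neg]
  apply ang_upper hu (neg_ne_zero.2 hz) (neg_ne_zero.2 hw) (gridAdj_neg h) <;>
  · rw [hgt_neg]; linarith

/-! ### Planar universal chord theorem (discrete) -/

lemma adj_const {S : Finset (ℤ × ℤ)} (hS : connectedIn S) (N : ℤ × ℤ → ℝ) (t : ℤ × ℤ)
    (h : ∀ y ∈ S, ∀ y' ∈ S, gridAdj y y' → N (y + t) = N (y' + t)) :
    ∀ y ∈ S, ∀ y' ∈ S, N (y + t) = N (y' + t) := by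
  intro y hy y' hy'
  have := hS y hy y' hy'
  induction this with
  | refl => rfl
  | tail _ hbc ih => exact (ih hbc.1).trans (h _ hbc.1 _ hbc.2.1 hbc.2.2)

lemma hopf_add {S : Finset (ℤ × ℤ)} (hS : connectedIn S) {u : ℤ × ℤ} (hu : u ≠ 0)
    {m n : ℤ} (hm : 0 < m) (hn : 0 < n) (h1 : ¬ realises S (m • u)) (h2 : ¬ realises S (n • u)) :
    ¬ realises S ((m + n) • u) := by
  rintro ⟨z, hz, z', hz', hzz⟩
  have hne : S.Nonempty := ⟨z, hz⟩
  obtain ⟨b, hb, hbmin⟩ := S.exists_min_image (hgt u) hne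
  obtain ⟨t, ht, htmax⟩ := S.exists_max_image (hgt u) hne
  have hw0 := hgt_smul hu (m + n)
  have hm0 := hgt_smul hu m
  -- the crucial non-vanishing facts
  have nz1 : ∀ x ∈ S, ∀ y ∈ S, x + m • u - (y + (0 : ℤ × ℤ)) ≠ 0 := by
    intro x hx y hy h
    exact h1 ⟨y, hy, x, hx, by rw [← sub_eq_zero, ← neg_eq_zero, ← h]; abel⟩
  have nz2 : ∀ x ∈ S, ∀ y ∈ S, x + m • u - (y + (m + n) • u) ≠ 0 := by
    intro x hx y hy h
    exact h2 ⟨x, hx, y, hy, by rw [← sub_eq_zero, ← h, add_smul]; abel⟩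
  have adj' : ∀ x y y' : ℤ × ℤ, gridAdj y y' → gridAdj (x - y) (x - y') := by
    intro x y y' h
    have := gridAdj_add (gridAdj_neg h) x
    rwa [neg_add_eq_sub, neg_add_eq_sub] at this
  have adj'' : ∀ x x' y : ℤ × ℤ, gridAdj x x' → gridAdj (x + m • u - y) (x' + m • u - y) := by
    intro x x' y h
    have := gridAdj_add h (m • u - y)
    rwa [← add_sub_assoc, ← add_sub_assoc] at this
  have main : ∀ x, Relation.ReflTransGen (fun x y => x ∈ S ∧ y ∈ S ∧ gridAdj x y) b x →
      ∃ Θ : ℤ × ℤ → ℝ,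
        (∀ y y', gridAdj y y' → (∀ s ∈ S, s + m • u - y ≠ 0) → (∀ s ∈ S, s + m • u - y' ≠ 0) →
          Θ y' - Θ y = ang (x + m • u - y) (x + m • u - y')
            - ang (b + m • u - y) (b + m • u - y')) ∧
        Θ (b + 0) = bet u (x + m • u - (b + 0)) - bet u (b + m • u - (b + 0)) ∧
        Θ (b + (m + n) • u) = bet u (x + m • u - (b + (m + n) • u))
          - bet u (b + m • u - (b + (m + n) • u)) := by
    intro x hx
    induction hx with
    | refl => exact ⟨fun _ => 0, by intros; simp, by simp, by simp⟩
    | @tail x x' _ hxx ih =>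
      obtain ⟨Θ, e1, e2, e3⟩ := ih
      obtain ⟨hx, hx', hadj⟩ := hxx
      refine ⟨fun y => Θ y + ang (x + m • u - y) (x' + m • u - y), ?_, ?_, ?_⟩
      · intro y y' hy h h'
        have := ang_square (h x hx) (h x' hx') (h' x hx) (h' x' hx') (adj'' _ _ _ hadj)
          (adj' _ _ _ hy) (adj' _ _ _ hy) (adj'' _ _ _ hadj)
        have := e1 y y' hy h h'
        simp only
        linarith
      · simp only
        rw [e2, ang_upper hu (nz1 x hx b hb) (nz1 x' hx' b hb) (adj'' _ _ _ hadj)]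
        · ring
        · have := hbmin x hx
          simp only [add_zero, hgt_sub, hgt_add, hm0]; linarith
        · have := hbmin x' hx'
          simp only [add_zero, hgt_sub, hgt_add, hm0]; linarith
      · simp only
        rw [e3, ang_upper hu (nz2 x hx b hb) (nz2 x' hx' b hb) (adj'' _ _ _ hadj)]
        · ring
        · have := hbmin x hx
          simp only [hgt_sub, hgt_add, hm0, hw0]; linarith
        · have := hbmin x' hx'
          simp only [hgt_sub, hgt_add, hm0, hw0]; linarith
  obtain ⟨Θ, e1, e2, e3⟩ := main t (hS b hb t ht)
  let N : ℤ × ℤ → ℝ := fun y => Θ y - bet u (t + m • u - y) + bet u (-(b + m • u - y))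
  have step : ∀ τ : ℤ × ℤ, hgt u τ = 0 → (∀ x ∈ S, ∀ y ∈ S, x + m • u - (y + τ) ≠ 0) →
      ∀ y ∈ S, ∀ y' ∈ S, gridAdj y y' → N (y + τ) = N (y' + τ) := by
    intro τ hτ nz y hy y' hy' hadj
    have had := gridAdj_add hadj τ
    have k1 := e1 _ _ had (fun s hs => nz s hs y hy) (fun s hs => nz s hs y' hy')
    have k2 := ang_upper hu (nz t ht y hy) (nz t ht y' hy') (adj' _ _ _ had)
      (by have := htmax y hy; simp only [hgt_sub, hgt_add, hm0, hτ]; linarith)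
      (by have := htmax y' hy'; simp only [hgt_sub, hgt_add, hm0, hτ]; linarith)
    have k3 := ang_lower hu (nz b hb y hy) (nz b hb y' hy') (adj' _ _ _ had)
      (by have := hbmin y hy; simp only [hgt_sub, hgt_add, hm0, hτ]; linarith)
      (by have := hbmin y' hy'; simp only [hgt_sub, hgt_add, hm0, hτ]; linarith)
    simp only [N]
    linarith
  have c1 := adj_const hS N 0 (step 0 (by simpa using hgt_smul hu 0) nz1) b hb z hz
  have c2 := adj_const hS N _ (step _ hw0 nz2) b hb z' hz'
  have hzz' : z + 0 = z' + (m + n) • u := by rw [← hzz]; abel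
  have c3 : N (b + 0) = N (b + (m + n) • u) := by rw [c1, c2, hzz']
  have s1 : b + m • u - (b + 0) = m • u := by abel
  have s2 : -(m • u) = (-m) • u := by rw [neg_smul]
  have s3 : b + m • u - (b + (m + n) • u) = (-n) • u := by rw [add_smul, neg_smul]; abel
  have s4 : -((-n) • u) = n • u := by rw [neg_smul, neg_neg]
  simp only [N] at c3
  rw [e2, e3, s1, s2, s3, s4, bet_pos hu m hm, bet_pos hu n hn, bet_neg hu (-m) (by omega),
    bet_neg hu (-n) (by omega)] at c3
  have := Real.pi_pos
  linarith

lemma hopf {S : Finset (ℤ × ℤ)} (hS : connectedIn S) {u : ℤ × ℤ} (hu : u ≠ 0)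
    (h1 : ¬ realises S u) {n : ℤ} (hn : 0 < n) : ¬ realises S (n • u) := by
  have hn' : 1 ≤ n := hn
  induction n, hn' using Int.leInduction with
  | base => simpa using h1
  | succ k hk ih => exact hopf_add hS hu hk one_pos (ih hk) (by simpa using h1)

lemma label_unique {S : Finset (ℤ × ℤ)} (hS : connectedIn S) {u : ℤ × ℤ} (hu : u ≠ 0)
    (h1 : ¬ realises S u) {x : ℤ × ℤ} {k l : ℤ} (hk : x + k • u ∈ S) (hl : x + l • u ∈ S) :
    k = l := by
  by_contra hne
  rcases lt_or_gt_of_ne hne with h | h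
  · exact hopf hS hu h1 (sub_pos.2 h) ⟨_, hl, _, hk, by rw [sub_smul]; abel⟩
  · exact hopf hS hu h1 (sub_pos.2 h) ⟨_, hk, _, hl, by rw [sub_smul]; abel⟩

/-! ### Connected sets -/

lemma conn_mono {S T : Finset (ℤ × ℤ)} (h : S ⊆ T) {x y : ℤ × ℤ}
    (hr : Relation.ReflTransGen (fun x y => x ∈ S ∧ y ∈ S ∧ gridAdj x y) x y) :
    Relation.ReflTransGen (fun x y => x ∈ T ∧ y ∈ T ∧ gridAdj x y) x y :=
  by
  induction hr with
  | refl => exact .refl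
  | tail _ h' ih => exact ih.tail ⟨h h'.1, h h'.2.1, h'.2.2⟩

lemma conn_union {S T : Finset (ℤ × ℤ)} (hS : connectedIn S) (hT : connectedIn T) {z : ℤ × ℤ}
    (h1 : z ∈ S) (h2 : z ∈ T) : connectedIn (S ∪ T) := by
  have a1 : ∀ x ∈ S ∪ T,
      Relation.ReflTransGen (fun x y => x ∈ S ∪ T ∧ y ∈ S ∪ T ∧ gridAdj x y) x z := by
    intro x hx
    rcases Finset.mem_union.1 hx with h | h
    · exact conn_mono Finset.subset_union_left (hS x h z h1)
    · exact conn_mono Finset.subset_union_right (hT x h z h2)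
  have a2 : ∀ x ∈ S ∪ T,
      Relation.ReflTransGen (fun x y => x ∈ S ∪ T ∧ y ∈ S ∪ T ∧ gridAdj x y) z x := by
    intro x hx
    rcases Finset.mem_union.1 hx with h | h
    · exact conn_mono Finset.subset_union_left (hS z h1 x h)
    · exact conn_mono Finset.subset_union_right (hT z h2 x h)
  exact fun x hx y hy => (a1 x hx).trans (a2 y hy)

lemma conn_single (x : ℤ × ℤ) : connectedIn {x} := by
  intro a ha b hb
  rw [Finset.mem_singleton] at ha hb
  rw [ha, hb]

lemma conn_pair {x y : ℤ × ℤ} (h : gridAdj x y) : connectedIn {x, y} := by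
  intro a ha b hb
  have e1 : Relation.ReflTransGen (fun p q => p ∈ ({x, y} : Finset (ℤ × ℤ)) ∧
      q ∈ ({x, y} : Finset (ℤ × ℤ)) ∧ gridAdj p q) x y := .single ⟨by simp, by simp, h⟩
  have e2 : Relation.ReflTransGen (fun p q => p ∈ ({x, y} : Finset (ℤ × ℤ)) ∧
      q ∈ ({x, y} : Finset (ℤ × ℤ)) ∧ gridAdj p q) y x :=
    .single ⟨by simp, by simp, gridAdj_symm h⟩
  simp only [Finset.mem_insert, Finset.mem_singleton] at ha hb
  rcases ha with rfl | rfl <;> rcases hb with rfl | rfl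
  · exact .refl
  · exact e1
  · exact e2
  · exact .refl

/-- translate of a finite set -/
def tr (t : ℤ × ℤ) (S : Finset (ℤ × ℤ)) : Finset (ℤ × ℤ) := S.image (fun x => x + t)

lemma mem_tr {t : ℤ × ℤ} {S : Finset (ℤ × ℤ)} {x : ℤ × ℤ} : x ∈ tr t S ↔ ∃ y ∈ S, y + t = x := by
  simp only [tr, Finset.mem_image]

lemma tr_mem {t : ℤ × ℤ} {S : Finset (ℤ × ℤ)} {x : ℤ × ℤ} (h : x ∈ S) : x + t ∈ tr t S :=
  mem_tr.2 ⟨x, h, rfl⟩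

lemma conn_tr {S : Finset (ℤ × ℤ)} (hS : connectedIn S) (t : ℤ × ℤ) : connectedIn (tr t S) := by
  intro a ha b hb
  obtain ⟨x, hx, rfl⟩ := mem_tr.1 ha
  obtain ⟨y, hy, rfl⟩ := mem_tr.1 hb
  have h := hS x hx y hy
  clear hb
  induction h with
  | refl => exact .refl
  | tail _ h ih => exact (ih h.1).tail ⟨tr_mem h.1, tr_mem h.2.1, gridAdj_add h.2.2 t⟩

lemma realises_tr {S : Finset (ℤ × ℤ)} {t w : ℤ × ℤ} (h : realises (tr t S) w) :
    realises S w := by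
  obtain ⟨a, ha, b, hb, hab⟩ := h
  obtain ⟨x, hx, rfl⟩ := mem_tr.1 ha
  obtain ⟨y, hy, rfl⟩ := mem_tr.1 hb
  exact ⟨x, hx, y, hy, by rw [← hab]; abel⟩

/-- Selecting a sub-path between labelled points. -/
lemma select {S : Finset (ℤ × ℤ)} (P N : ℤ × ℤ → Prop) {p q : ℤ × ℤ} (hp : p ∈ S) (hq : q ∈ S)
    (hN : N q) (h : Relation.ReflTransGen (fun x y => x ∈ S ∧ y ∈ S ∧ gridAdj x y) p q) :
    (∃ T ⊆ S, connectedIn T ∧ ∃ p' ∈ T, ∃ q' ∈ T, P p' ∧ N q' ∧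
      ∀ x ∈ T, P x ∨ N x → x = p' ∨ x = q') ∨
    (∃ T ⊆ S, connectedIn T ∧ p ∈ T ∧ ∃ q' ∈ T, N q' ∧ ∀ x ∈ T, P x ∨ N x → x = q') := by
  have single : ∀ y ∈ S, N y →
      (∃ T ⊆ S, connectedIn T ∧ y ∈ T ∧ ∃ q' ∈ T, N q' ∧ ∀ x ∈ T, P x ∨ N x → x = q') := by
    intro y hy hNy
    exact ⟨{y}, by simpa using hy, conn_single y, by simp, y, by simp, hNy, by simp⟩
  induction h using Relation.ReflTransGen.head_induction_on with
  | refl => exact Or.inr (single q hq hN)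
  | @head a c hac _ ih =>
    obtain ⟨ha, hc, hadj⟩ := hac
    rcases ih hc with ih | ⟨T, hTS, hT, hcT, q', hq', hNq', hx⟩
    · exact Or.inl ih
    by_cases hNa : N a
    · exact Or.inr (single a ha hNa)
    have hconn : connectedIn ({a, c} ∪ T) := conn_union (conn_pair hadj) hT (by simp) hcT
    have hsub : ({a, c} ∪ T) ⊆ S := by
      intro x hx
      simp only [Finset.mem_union, Finset.mem_insert, Finset.mem_singleton] at hx
      rcases hx with (rfl | rfl) | h
      · exact ha
      · exact hc
      · exact hTS h
    have hmem : ∀ x ∈ ({a, c} ∪ T : Finset (ℤ × ℤ)), x = a ∨ x ∈ T := by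
      intro x hx
      simp only [Finset.mem_union, Finset.mem_insert, Finset.mem_singleton] at hx
      rcases hx with (rfl | rfl) | h
      · exact Or.inl rfl
      · exact Or.inr hcT
      · exact Or.inr h
    by_cases hPa : P a
    · left
      refine ⟨_, hsub, hconn, a, by simp, q', Finset.mem_union_right _ hq', hPa, hNq', ?_⟩
      intro x hxm hl
      rcases hmem x hxm with h | h
      · exact Or.inl h
      · exact Or.inr (hx x h hl)
    · right
      refine ⟨_, hsub, hconn, by simp, q', Finset.mem_union_right _ hq', hNq', ?_⟩
      intro x hxm hl
      rcases hmem x hxm with rfl | h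
      · exact absurd hl (by tauto)
      · exact hx x h hl

/-! ### Franks' lemma for translations -/

/-- some positive iterate of the translation by `u` sends a point of `D` into `E` -/
def goes (u : ℤ × ℤ) (D E : Finset (ℤ × ℤ)) : Prop := ∃ n : ℤ, 0 < n ∧ ∃ x ∈ D, x + n • u ∈ E

lemma not_goes_self {u : ℤ × ℤ} (hu : u ≠ 0) {D : Finset (ℤ × ℤ)} (hD : connectedIn D)
    (hf : ¬ realises D u) : ¬ goes u D D := by
  rintro ⟨n, hn, x, hx, hxn⟩
  exact hopf hD hu hf hn ⟨_, hxn, _, hx, by abel⟩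

/-- the possible chords `u` in `tr (a • u) T ∪ D` -/
lemma free_union {u : ℤ × ℤ} {T D : Finset (ℤ × ℤ)} {a : ℤ} (hT : ¬ realises T u)
    (hD : ¬ realises D u) (h : realises (tr (a • u) T ∪ D) u) :
    ∃ x ∈ T, x + (a - 1) • u ∈ D ∨ x + (a + 1) • u ∈ D := by
  obtain ⟨x, hx, y, hy, hxy⟩ := h
  rcases Finset.mem_union.1 hx with hx | hx <;> rcases Finset.mem_union.1 hy with hy | hy
  · exact absurd (realises_tr ⟨x, hx, y, hy, hxy⟩) hT
  · obtain ⟨x0, hx0, rfl⟩ := mem_tr.1 hx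
    refine ⟨x0, hx0, Or.inl ?_⟩
    have : x0 + (a - 1) • u = y := by
      rw [sub_smul, one_smul]; nth_rewrite 2 [← hxy]; abel
    rwa [this]
  · obtain ⟨y0, hy0, rfl⟩ := mem_tr.1 hy
    refine ⟨y0, hy0, Or.inr ?_⟩
    have : y0 + (a + 1) • u = x := by
      rw [add_smul, one_smul]; nth_rewrite 2 [← hxy]; abel
    rwa [this]
  · exact absurd ⟨x, hx, y, hy, hxy⟩ hD

lemma two_cycle {u : ℤ × ℤ} (hu : u ≠ 0) {D E : Finset (ℤ × ℤ)} (hD : connectedIn D)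
    (hE : connectedIn E) (hDf : ¬ realises D u) (hEf : ¬ realises E u) (hdis : Disjoint D E)
    (h1 : goes u D E) (h2 : goes u E D) : False := by
  obtain ⟨n, hn, q, hq, hqn⟩ := h1
  obtain ⟨m, hm, p, hp, hpm⟩ := h2
  have hP0 : ∃ k : ℤ, k < 0 ∧ (p + m • u) + k • u ∈ E :=
    ⟨-m, by omega, by rw [neg_smul, add_neg_cancel_right]; exact hp⟩
  have hgood : ∃ T ⊆ D, connectedIn T ∧ ∃ p' ∈ T, ∃ q' ∈ T, (∃ k : ℤ, k < 0 ∧ p' + k • u ∈ E) ∧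
      (∃ k : ℤ, 0 < k ∧ q' + k • u ∈ E) ∧
      ∀ x ∈ T, (∃ k : ℤ, k < 0 ∧ x + k • u ∈ E) ∨ (∃ k : ℤ, 0 < k ∧ x + k • u ∈ E) →
        x = p' ∨ x = q' := by
    rcases select (fun x => ∃ k : ℤ, k < 0 ∧ x + k • u ∈ E)
      (fun x => ∃ k : ℤ, 0 < k ∧ x + k • u ∈ E) hpm hq ⟨n, hn, hqn⟩ (hD _ hpm _ hq) with h | h
    · exact h
    · obtain ⟨T, -, -, hpT, q', -, ⟨k, hk, hkq⟩, hx⟩ := h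
      have := hx _ hpT (Or.inl hP0)
      obtain ⟨l, hl, hlE⟩ := hP0
      rw [this] at hlE
      have := label_unique hE hu hEf hkq hlE
      omega
  obtain ⟨T, hTD, hT, p', hp', q', hq', ⟨c, hc, hcE⟩, ⟨a, ha, haE⟩, hx⟩ := hgood
  have hTf : ¬ realises T u := fun ⟨x, hx, y, hy, h⟩ => hDf ⟨x, hTD hx, y, hTD hy, h⟩
  have hX : connectedIn (tr (a • u) T ∪ E) := conn_union (conn_tr hT _) hE (tr_mem hq') haE
  have hXu : realises (tr (a • u) T ∪ E) u := by
    by_contra hno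
    refine hopf hX hu hno (n := a - c) (by omega)
      ⟨p' + a • u, Finset.mem_union_left _ (tr_mem hp'), p' + c • u,
        Finset.mem_union_right _ hcE, ?_⟩
    rw [sub_smul]; abel
  have key : ∀ x ∈ T, ∀ k : ℤ, x + k • u ∈ E → k = c ∨ k = a := by
    intro x hxT k hk
    have hlab : x = p' ∨ x = q' := by
      apply hx x hxT
      rcases lt_trichotomy k 0 with h | h | h
      · exact Or.inl ⟨k, h, hk⟩
      · rw [h, zero_smul, add_zero] at hk
        exact absurd hk (Finset.disjoint_left.1 hdis (hTD hxT))
      · exact Or.inr ⟨k, h, hk⟩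
    rcases hlab with rfl | rfl
    · exact Or.inl (label_unique hE hu hEf hk hcE)
    · exact Or.inr (label_unique hE hu hEf hk haE)
  obtain ⟨x, hxT, h | h⟩ := free_union hTf hEf hXu
  · rcases key x hxT _ h with h | h <;> omega
  · rcases key x hxT _ h with h | h <;> omega

lemma franks {u : ℤ × ℤ} (hu : u ≠ 0) : ∀ (n : ℕ) (D : Finset (ℤ × ℤ))
    (L : List (Finset (ℤ × ℤ))), L.length = n →
    (∀ E ∈ D :: L, connectedIn E ∧ ¬ realises E u) →
    (∀ E ∈ D :: L, ∀ F ∈ D :: L, E = F ∨ Disjoint E F) →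
    List.IsChain (goes u) (D :: L ++ [D]) → False := by
  intro n
  induction n using Nat.strong_induction_on with
  | _ n ih =>
  intro D L hlen hgood hdis hch
  obtain ⟨hD, hDf⟩ := hgood D (by simp)
  rcases L with _ | ⟨E, L⟩
  · simp at hch
    exact not_goes_self hu hD hDf hch
  obtain ⟨hE, hEf⟩ := hgood E (by simp)
  simp only [List.length_cons] at hlen
  simp only [List.cons_append, List.isChain_cons_cons] at hch
  obtain ⟨hDE, hch⟩ := hch
  -- D does not reappear
  by_cases hDL : D ∈ E :: L
  · obtain ⟨l1, l2, hl⟩ := List.append_of_mem hDL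
    have hlen2 : l1.length + l2.length = L.length := by
      have := congrArg List.length hl
      simp at this; omega
    have hsub : ∀ F ∈ D :: l2, F ∈ D :: E :: L := by
      intro F hF
      rw [hl]; simp at hF ⊢; tauto
    refine ih l2.length (by omega) D l2 rfl (fun F hF => hgood F (hsub F hF))
      (fun F hF F' hF' => hdis F (hsub F hF) F' (hsub F' hF')) ?_
    rw [← List.cons_append, hl] at hch
    refine hch.suffix ⟨l1, by simp⟩
  by_cases hEL : E ∈ L
  · obtain ⟨l1, l2, rfl⟩ := List.append_of_mem hEL
    have hsub : ∀ F ∈ E :: l1, F ∈ D :: E :: (l1 ++ E :: l2) := by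
      intro F hF
      simp at hF ⊢; tauto
    refine ih l1.length (by simp at hlen; omega) E l1 rfl (fun F hF => hgood F (hsub F hF))
      (fun F hF F' hF' => hdis F (hsub F hF) F' (hsub F' hF')) ?_
    have e : E :: (l1 ++ E :: l2 ++ [D]) = (E :: l1 ++ [E]) ++ (l2 ++ [D]) := by simp
    rw [e] at hch
    exact (List.isChain_append.1 hch).1
  by_cases hshort : ∃ F ∈ L, goes u D F
  · obtain ⟨F, hF, hDF⟩ := hshort
    obtain ⟨l1, l2, rfl⟩ := List.append_of_mem hF
    have hsub : ∀ G ∈ D :: F :: l2, G ∈ D :: E :: (l1 ++ F :: l2) := by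
      intro G hG
      simp at hG ⊢; tauto
    refine ih (F :: l2).length (by simp at hlen ⊢; omega) D (F :: l2) rfl
      (fun F hF => hgood F (hsub F hF))
      (fun F hF F' hF' => hdis F (hsub F hF) F' (hsub F' hF')) ?_
    simp only [List.cons_append, List.isChain_cons_cons]
    exact ⟨hDF, hch.suffix ⟨E :: l1, by simp⟩⟩
  have hDEdis : Disjoint D E := (hdis D (by simp) E (by simp)).resolve_left
    (fun h => hDL (by simp [h]))
  by_cases hED : goes u E D
  · exact two_cycle hu hD hE hDf hEf hDEdis hDE hED
  rcases List.eq_nil_or_concat L with rfl | ⟨l, F, hlF⟩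
  · simp at hch
    exact hED hch
  rw [List.concat_eq_append] at hlF
  have hFD : goes u F D := by
    have : List.IsChain (goes u) [F, D] := hch.suffix ⟨E :: l, by simp [hlF]⟩
    simpa using this
  obtain ⟨m, hm, z, hz, hzm⟩ := hFD
  obtain ⟨k, hk, q, hq, hqk⟩ := hDE
  obtain ⟨T, hTD, hT, hpT, q', hq', ⟨a, ha, haE⟩, hx⟩ : ∃ T ⊆ D, connectedIn T ∧ z + m • u ∈ T ∧
      ∃ q' ∈ T, (∃ k : ℤ, 0 < k ∧ q' + k • u ∈ E) ∧
        ∀ x ∈ T, False ∨ (∃ k : ℤ, 0 < k ∧ x + k • u ∈ E) → x = q' := by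
    rcases select (fun _ => False)
      (fun x => ∃ k : ℤ, 0 < k ∧ x + k • u ∈ E) hzm hq ⟨k, hk, hqk⟩ (hD _ hzm _ hq) with h | h
    · obtain ⟨_, _, _, _, _, _, _, h, _⟩ := h
      exact h.elim
    · exact h
  have hTf : ¬ realises T u := fun ⟨x, hx, y, hy, h⟩ => hDf ⟨x, hTD hx, y, hTD hy, h⟩
  have hX : connectedIn (tr (a • u) T ∪ E) := conn_union (conn_tr hT _) hE (tr_mem hq') haE
  have key : ∀ x ∈ T, ∀ k : ℤ, x + k • u ∈ E → k = a := by
    intro x hxT k hk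
    rcases lt_trichotomy k 0 with h | h | h
    · exact absurd ⟨-k, by omega, _, hk, by
        rw [neg_smul, add_neg_cancel_right]; exact hTD hxT⟩ hED
    · rw [h, zero_smul, add_zero] at hk
      exact absurd hk (Finset.disjoint_left.1 hDEdis (hTD hxT))
    · have := hx x hxT (Or.inr ⟨k, h, hk⟩)
      subst this
      exact label_unique hE hu hEf hk haE
  have hXf : ¬ realises (tr (a • u) T ∪ E) u := by
    intro h
    obtain ⟨x, hxT, h | h⟩ := free_union hTf hEf h
    · have := key x hxT _ h; omega
    · have := key x hxT _ h; omega
  have hXdis : ∀ G ∈ L, Disjoint (tr (a • u) T ∪ E) G := by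
    intro G hG
    rw [Finset.disjoint_union_left]
    constructor
    · rw [Finset.disjoint_left]
      intro x hx hxG
      obtain ⟨y, hy, rfl⟩ := mem_tr.1 hx
      exact hshort ⟨G, hG, a, ha, y, hTD hy, hxG⟩
    · exact (hdis E (by simp) G (by simp [hG])).resolve_left (fun h => hEL (h ▸ hG))
  refine ih L.length (by omega) (tr (a • u) T ∪ E) L rfl ?_ ?_ ?_
  · intro G hG
    rcases List.mem_cons.1 hG with rfl | hG
    · exact ⟨hX, hXf⟩
    · exact hgood G (by simp [hG])
  · intro G hG G' hG'
    rcases List.mem_cons.1 hG with rfl | hG <;> rcases List.mem_cons.1 hG' with rfl | hG'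
    · exact Or.inl rfl
    · exact Or.inr (hXdis _ hG')
    · exact Or.inr (hXdis _ hG).symm
    · exact hdis G (by simp [hG]) G' (by simp [hG'])
  · have hFX : goes u F (tr (a • u) T ∪ E) := by
      refine ⟨m + a, by omega, z, hz, Finset.mem_union_left _ ?_⟩
      rw [add_smul, ← add_assoc]
      exact tr_mem hpT
    have hmid : List.IsChain (goes u) (E :: L) := List.IsChain.left_of_append (l₁ := E :: L) (l₂ := [D]) hch
    have hup : ∀ G, goes u E G → goes u (tr (a • u) T ∪ E) G :=
      fun G ⟨i, hi, x, hx, h⟩ => ⟨i, hi, x, Finset.mem_union_right _ hx, h⟩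
    have hXL : List.IsChain (goes u) ((tr (a • u) T ∪ E) :: L) := by
      rw [List.isChain_cons] at hmid ⊢
      exact ⟨fun G hG => hup G (hmid.1 G hG), hmid.2⟩
    rw [List.isChain_append]
    refine ⟨hXL, by simp, ?_⟩
    intro x hx y hy
    have hx' : x = F := by
      rw [hlF] at hx
      simp [List.getLast?_cons] at hx
      exact hx.symm
    have hy' : y = tr (a • u) T ∪ E := by simpa using hy.symm
    rw [hx', hy']
    exact hFX

/-! ### Main argument -/

lemma realises_neg {S : Finset (ℤ × ℤ)} {w : ℤ × ℤ} (h : realises S w) : realises S (-w) := by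
  obtain ⟨a, ha, b, hb, h⟩ := h
  exact ⟨b, hb, a, ha, by rw [← h]; abel⟩

lemma transGen_steps (r : ℤ → ℤ → Prop) (s : ℤ) (h : ∀ i, r i (i + s)) (n : ℕ) (i : ℤ) :
    Relation.TransGen r i (i + (n + 1) * s) := by
  induction n with
  | zero => simpa using Relation.TransGen.single (h i)
  | succ n ih =>
    refine ih.tail ?_
    have := h (i + (n + 1) * s)
    convert this using 1
    push_cast; ring

lemma main_pos {a b c d : ℤ} (ha : 0 < a) (hc : 0 < c) (hb : 0 < b) (hd : d < 0)
    {u v : ℤ × ℤ} (hu : u ≠ 0) (hv : v ≠ 0) {S : Finset (ℤ × ℤ)} (hconn : connectedIn S)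
    (h₁ : realises S (a • u + b • v)) (h₂ : realises S (c • u + d • v))
    (hSu : ¬ realises S u) (hSv : ¬ realises S v) : False := by
  let r : ℤ → ℤ → Prop := fun i j => goes u (tr (i • v) S) (tr (j • v) S)
  have step : ∀ n k : ℤ, 0 < n → realises S (n • u + k • v) → ∀ i, r i (i + -k) := by
    rintro n k hn ⟨y, hy, x, hx, hxy⟩ i
    refine ⟨n, hn, x + i • v, tr_mem hx, mem_tr.2 ⟨y, hy, ?_⟩⟩
    have : y = x + n • u + k • v := by rw [add_assoc, ← hxy]; abel
    rw [this, add_smul, neg_smul]; abel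
  have t1 := transGen_steps r (-b) (step a b ha h₁) ((-d).toNat - 1) 0
  have t2 := transGen_steps r (-d) (step c d hc h₂) (b.toNat - 1)
    (0 + ((((-d).toNat - 1 : ℕ) : ℤ) + 1) * (-b))
  have e1 : ((((-d).toNat - 1 : ℕ) : ℤ) + 1) = -d := by omega
  have e2 : (((b.toNat - 1 : ℕ) : ℤ) + 1) = b := by omega
  have t3 := t1.trans t2
  rw [e1, e2] at t3
  have e3 : 0 + -d * -b + b * -d = 0 := by ring
  rw [e3] at t3
  obtain ⟨j, h0j, hj0⟩ := Relation.TransGen.tail'_iff.1 t3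
  obtain ⟨l, hl, hlast⟩ := List.exists_isChain_cons_of_relationReflTransGen h0j
  refine franks hu l.length (tr ((0 : ℤ) • v) S) (l.map fun i => tr (i • v) S) (by simp) ?_ ?_ ?_
  · intro E hE
    have : ∃ i : ℤ, E = tr (i • v) S := by
      rcases List.mem_cons.1 hE with h | h
      · exact ⟨0, h⟩
      · obtain ⟨i, _, h⟩ := List.mem_map.1 h
        exact ⟨i, h.symm⟩
    obtain ⟨i, rfl⟩ := this
    exact ⟨conn_tr hconn _, fun h => hSu (realises_tr h)⟩
  · have all : ∀ E ∈ tr ((0 : ℤ) • v) S :: (l.map fun i => tr (i • v) S),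
        ∃ i : ℤ, E = tr (i • v) S := by
      intro E hE
      rcases List.mem_cons.1 hE with h | h
      · exact ⟨0, h⟩
      · obtain ⟨i, _, h⟩ := List.mem_map.1 h
        exact ⟨i, h.symm⟩
    intro E hE F hF
    obtain ⟨i, rfl⟩ := all E hE
    obtain ⟨k, rfl⟩ := all F hF
    by_cases hik : i = k
    · exact Or.inl (by rw [hik])
    right
    rw [Finset.disjoint_left]
    intro x hx hx'
    obtain ⟨y, hy, rfl⟩ := mem_tr.1 hx
    obtain ⟨y', hy', h⟩ := mem_tr.1 hx'
    have e : y + (i - k) • v = y' := by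
      rw [sub_smul, ← add_sub_assoc, ← h]; abel
    have := label_unique hconn hv hSv (x := y) (k := i - k) (l := 0) (by rw [e]; exact hy')
      (by simpa using hy)
    omega
  · have hmap : List.IsChain (goes u) ((0 :: l).map fun i : ℤ => tr (i • v) S) :=
      (List.isChain_map _).2 hl
    rw [List.map_cons] at hmap
    rw [List.isChain_append]
    refine ⟨hmap, by simp, ?_⟩
    intro x hx y hy
    have hy' : y = tr ((0 : ℤ) • v) S := by simpa using hy.symm
    have hx' : x = tr (j • v) S := by
      rw [← List.map_cons (f := fun i : ℤ => tr (i • v) S), List.getLast?_map,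
        List.getLast?_eq_some_getLast (by simp), hlast] at hx
      simpa using hx.symm
    rw [hx', hy']
    exact hj0

theorem discrete_forced_pair (a b c d : ℤ) (habcd : a * b * c * d < 0)
    (u v : ℤ × ℤ) (huv : nonParallel u v)
    (S : Finset (ℤ × ℤ)) (hconn : connectedIn S)
    (h₁ : realises S (a • u + b • v)) (h₂ : realises S (c • u + d • v)) :
    realises S u ∨ realises S v := by
  by_contra hcon
  push Not at hcon
  obtain ⟨hSu, hSv⟩ := hcon
  have hu : u ≠ 0 := by
    rintro rfl; exact huv (by simp)
  have hv : v ≠ 0 := by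
    rintro rfl; exact huv (by simp)
  have key : ∀ a b : ℤ, realises S (a • u + b • v) → 0 < a * b →
      ∃ a' b' : ℤ, 0 < a' ∧ 0 < b' ∧ realises S (a' • u + b' • v) := by
    intro a b h hab
    rcases pos_and_pos_or_neg_and_neg_of_mul_pos hab with ⟨h1, h2⟩ | ⟨h1, h2⟩
    · exact ⟨a, b, h1, h2, h⟩
    · refine ⟨-a, -b, by omega, by omega, ?_⟩
      have := realises_neg h
      rwa [neg_add, ← neg_smul, ← neg_smul] at this
  have key' : ∀ a b : ℤ, realises S (a • u + b • v) → a * b < 0 →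
      ∃ a' b' : ℤ, 0 < a' ∧ b' < 0 ∧ realises S (a' • u + b' • v) := by
    intro a b h hab
    rcases mul_neg_iff.1 hab with ⟨h1, h2⟩ | ⟨h1, h2⟩
    · exact ⟨a, b, h1, h2, h⟩
    · refine ⟨-a, -b, by omega, by omega, ?_⟩
      have := realises_neg h
      rwa [neg_add, ← neg_smul, ← neg_smul] at this
  have hprod : (a * b) * (c * d) < 0 := by rw [← mul_assoc]; exact habcd
  rcases mul_neg_iff.1 hprod with ⟨p1, p2⟩ | ⟨p1, p2⟩
  · obtain ⟨a', b', ha, hb, h⟩ := key a b h₁ p1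
    obtain ⟨c', d', hc, hd, h'⟩ := key' c d h₂ p2
    exact main_pos ha hc hb hd hu hv hconn h h' hSu hSv
  · obtain ⟨a', b', ha, hb, h⟩ := key c d h₂ p2
    obtain ⟨c', d', hc, hd, h'⟩ := key' a b h₁ p1
    exact main_pos ha hc hb hd hu hv hconn h h' hSu hSv
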